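/- arXiv:2207.02575 — 3 statements merged into one kernel-verified Lean document; each statement's English description precedes it below -/
import Mathlib

section
/- Assume every φ ∈ Φ satisfies ‖φ‖₂ ≤ 1. Then for all symmetric positive semidefinite d×d real matrices Λ and Λ' with ‖Λ‖_op ≤ 1 and ‖Λ'‖_op ≤ 1, one has |f(Λ) − f(Λ')| ≤ ‖Λ₀⁻¹‖_op² · ‖Λ − Λ'‖_op. -/
open Matrix

/-- The ℓ₂→ℓ₂ operator norm of a square real matrix. -/
noncomputable def opNorm {d : ℕ} (M : Matrix (Fin d) (Fin d) ℝ) : ℝ :=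
  ‖Matrix.toEuclideanCLM (𝕜 := ℝ) M‖

/-- The smoothed XY-experiment-design objective. -/
noncomputable def smoothedXY {d : ℕ} (Φ : Finset (Fin d → ℝ))
    (Λ₀ : Matrix (Fin d) (Fin d) ℝ) (η : ℝ) (Λ : Matrix (Fin d) (Fin d) ℝ) : ℝ :=
  (1 / η) * Real.log (∑ φ ∈ Φ, Real.exp (η * (φ ⬝ᵥ (Λ + Λ₀)⁻¹ *ᵥ φ)))

open scoped InnerProductSpace in
/-- A positive symmetric operator is bounded below by the reciprocal of the norm of its inverse. -/
theorem norm_sq_le_norm_inverse_mul_inner {E : Type*} [NormedAddCommGroup E]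
    [InnerProductSpace ℝ E] {P Q : E →L[ℝ] E} (hQP : ∀ x, Q (P x) = x) (hPQ : ∀ x, P (Q x) = x)
    (hsymm : ∀ x y, ⟪P x, y⟫_ℝ = ⟪x, P y⟫_ℝ) (hpos : ∀ x, 0 ≤ ⟪x, P x⟫_ℝ) (x : E) :
    ‖x‖ ^ 2 ≤ ‖Q‖ * ⟪x, P x⟫_ℝ := by
  rcases (norm_nonneg Q).eq_or_lt with hc | hc
  · have h := Q.le_opNorm (P x)
    rw [hQP, ← hc, zero_mul] at h
    have h0 : ‖x‖ = 0 := le_antisymm h (norm_nonneg x)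
    simp [h0, ← hc]
  · have h := hpos (‖Q‖ • x - Q x)
    have h1 : ⟪Q x, P x⟫_ℝ = ‖x‖ ^ 2 := by
      rw [← hsymm, hPQ, real_inner_self_eq_norm_sq]
    have h2 : ⟪Q x, x⟫_ℝ ≤ ‖Q‖ * ‖x‖ ^ 2 := calc
      _ ≤ ‖Q x‖ * ‖x‖ := real_inner_le_norm _ _
      _ ≤ (‖Q‖ * ‖x‖) * ‖x‖ := by gcongr; exact Q.le_opNorm x
      _ = _ := by ring
    simp only [map_sub, map_smul, hPQ, inner_sub_left, inner_sub_right, real_inner_smul_left,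
      real_inner_smul_right, h1, real_inner_self_eq_norm_sq] at h
    refine le_of_mul_le_mul_left ?_ hc
    linarith

open scoped InnerProductSpace in
/-- Adding a positive semidefinite matrix does not increase the operator norm of the inverse. -/
theorem opNorm_inv_add_le {d : ℕ} {M N : Matrix (Fin d) (Fin d) ℝ} (hM : M.PosDef)
    (hN : N.PosSemidef) : opNorm (N + M)⁻¹ ≤ opNorm M⁻¹ := by
  have hA : (N + M).PosDef := hM.posSemidef_add hN
  have cancel {B C : Matrix (Fin d) (Fin d) ℝ} (h : B * C = 1) (x : EuclideanSpace ℝ (Fin d)) :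
      toEuclideanCLM (𝕜 := ℝ) B (toEuclideanCLM (𝕜 := ℝ) C x) = x := by
    rw [← mul_apply_eq_comp, ← map_mul, h, map_one, one_apply_eq_self]
  have hMdet := (Matrix.isUnit_iff_isUnit_det _).1 hM.isUnit
  have hAdet := (Matrix.isUnit_iff_isUnit_det _).1 hA.isUnit
  have nonneg {B : Matrix (Fin d) (Fin d) ℝ} (hB : B.PosSemidef)
      (x : EuclideanSpace ℝ (Fin d)) : 0 ≤ ⟪x, toEuclideanCLM (𝕜 := ℝ) B x⟫_ℝ := by
    rw [inner_toEuclideanCLM]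
    simpa using hB.dotProduct_mulVec_nonneg x.ofLp
  refine ContinuousLinearMap.opNorm_le_bound _ (norm_nonneg _) fun v => ?_
  set x := toEuclideanCLM (𝕜 := ℝ) (N + M)⁻¹ v with hx
  have hAx : toEuclideanCLM (𝕜 := ℝ) N x + toEuclideanCLM (𝕜 := ℝ) M x = v := by
    rw [← _root_.add_apply, ← map_add, hx]
    exact cancel (Matrix.mul_nonsing_inv _ hAdet) v
  have h1 : ‖x‖ ^ 2 ≤ opNorm M⁻¹ * ⟪x, toEuclideanCLM (𝕜 := ℝ) M x⟫_ℝ := by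
    refine norm_sq_le_norm_inverse_mul_inner (cancel (Matrix.nonsing_inv_mul _ hMdet))
      (cancel (Matrix.mul_nonsing_inv _ hMdet)) (fun y z => ?_) (nonneg hM.posSemidef) x
    rw [← ContinuousLinearMap.adjoint_inner_right, ← ContinuousLinearMap.star_eq_adjoint,
      ← map_star, star_eq_conjTranspose, hM.isHermitian.eq]
  have h2 : ⟪x, toEuclideanCLM (𝕜 := ℝ) M x⟫_ℝ ≤ ‖x‖ * ‖v‖ := by
    refine le_trans ?_ (real_inner_le_norm x v)
    rw [← hAx, inner_add_right]
    exact le_add_of_nonneg_left (nonneg hN x)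
  have h3 : ‖x‖ * ‖x‖ ≤ ‖x‖ * (opNorm M⁻¹ * ‖v‖) := by
    have := mul_le_mul_of_nonneg_left h2 (norm_nonneg (toEuclideanCLM (𝕜 := ℝ) M⁻¹))
    change opNorm M⁻¹ * _ ≤ opNorm M⁻¹ * _ at this
    nlinarith
  rcases (norm_nonneg x).eq_or_lt with h0 | h0
  · rw [← h0]
    exact mul_nonneg (norm_nonneg _) (norm_nonneg _)
  · exact le_of_mul_le_mul_left h3 h0

/-- The quadratic form of a matrix on the unit ball is bounded by its operator norm. -/
theorem dotProduct_mulVec_le_opNorm {d : ℕ} (M : Matrix (Fin d) (Fin d) ℝ) {v : Fin d → ℝ}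
    (hv : Real.sqrt (v ⬝ᵥ v) ≤ 1) : v ⬝ᵥ M *ᵥ v ≤ opNorm M := by
  have hnorm : ‖WithLp.toLp 2 v‖ ≤ 1 := by
    simpa [EuclideanSpace.norm_eq, dotProduct, sq] using hv
  have h := inner_toEuclideanCLM M (WithLp.toLp 2 v) (WithLp.toLp 2 v)
  have h' := real_inner_le_norm (WithLp.toLp 2 v) (toEuclideanCLM (𝕜 := ℝ) M (WithLp.toLp 2 v))
  have h'' := (toEuclideanCLM (𝕜 := ℝ) M).unit_le_opNorm _ hnorm
  rw [h] at h'
  calc v ⬝ᵥ M *ᵥ v ≤ ‖WithLp.toLp 2 v‖ * ‖toEuclideanCLM (𝕜 := ℝ) M (WithLp.toLp 2 v)‖ := h'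
    _ ≤ 1 * opNorm M := mul_le_mul hnorm h'' (norm_nonneg _) zero_le_one
    _ = opNorm M := one_mul _

theorem opNorm_mul_le {d : ℕ} (M N : Matrix (Fin d) (Fin d) ℝ) :
    opNorm (M * N) ≤ opNorm M * opNorm N := by
  unfold opNorm
  rw [map_mul]
  exact norm_mul_le _ _

theorem opNorm_sub_comm {d : ℕ} (M N : Matrix (Fin d) (Fin d) ℝ) :
    opNorm (M - N) = opNorm (N - M) := by
  unfold opNorm
  rw [map_sub, map_sub, norm_sub_rev]

/-- Inversion is Lipschitz, with constant `‖M⁻¹‖²`, on the matrices above `M`. -/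
theorem opNorm_inv_add_sub_inv_add_le {d : ℕ} {M N N' : Matrix (Fin d) (Fin d) ℝ}
    (hM : M.PosDef) (hN : N.PosSemidef) (hN' : N'.PosSemidef) :
    opNorm ((N + M)⁻¹ - (N' + M)⁻¹) ≤ opNorm M⁻¹ ^ 2 * opNorm (N - N') := by
  have hA := (Matrix.isUnit_iff_isUnit_det _).1 (hM.posSemidef_add hN).isUnit
  have hA' := (Matrix.isUnit_iff_isUnit_det _).1 (hM.posSemidef_add hN').isUnit
  have key : (N + M)⁻¹ - (N' + M)⁻¹ = (N + M)⁻¹ * (N' - N) * (N' + M)⁻¹ := by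
    rw [show N' - N = (N' + M) - (N + M) by abel, mul_sub, sub_mul, Matrix.nonsing_inv_mul _ hA,
      one_mul, mul_assoc, Matrix.mul_nonsing_inv _ hA', mul_one]
  have nonneg (B : Matrix (Fin d) (Fin d) ℝ) : 0 ≤ opNorm B := norm_nonneg _
  rw [key, opNorm_sub_comm N N']
  calc _ ≤ opNorm ((N + M)⁻¹ * (N' - N)) * opNorm (N' + M)⁻¹ := opNorm_mul_le _ _
    _ ≤ (opNorm (N + M)⁻¹ * opNorm (N' - N)) * opNorm (N' + M)⁻¹ :=
      mul_le_mul_of_nonneg_right (opNorm_mul_le _ _) (nonneg _)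
    _ ≤ (opNorm M⁻¹ * opNorm (N' - N)) * opNorm M⁻¹ :=
      mul_le_mul (mul_le_mul_of_nonneg_right (opNorm_inv_add_le hM hN) (nonneg _))
        (opNorm_inv_add_le hM hN') (nonneg _) (mul_nonneg (nonneg _) (nonneg _))
    _ = _ := by ring

/-- The smoothed maximum is monotone and commutes with adding constants. -/
theorem smoothed_max_le_add {ι : Type*} {s : Finset ι} (hs : s.Nonempty) {η K : ℝ} (hη : 0 < η)
    {a b : ι → ℝ} (h : ∀ i ∈ s, a i ≤ b i + K) :
    (1 / η) * Real.log (∑ i ∈ s, Real.exp (η * a i)) ≤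
      (1 / η) * Real.log (∑ i ∈ s, Real.exp (η * b i)) + K := by
  have hpos (c : ι → ℝ) : 0 < ∑ i ∈ s, Real.exp (η * c i) :=
    Finset.sum_pos (fun i _ => Real.exp_pos _) hs
  have hsum : ∑ i ∈ s, Real.exp (η * a i) ≤ (∑ i ∈ s, Real.exp (η * b i)) * Real.exp (η * K) := by
    rw [Finset.sum_mul]
    refine Finset.sum_le_sum fun i hi => ?_
    rw [← Real.exp_add, ← mul_add]
    exact Real.exp_le_exp.2 (mul_le_mul_of_nonneg_left (h i hi) hη.le)
  have hlog := Real.log_le_log (hpos a) hsum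
  rw [Real.log_mul (hpos b).ne' (Real.exp_pos _).ne', Real.log_exp] at hlog
  calc _ ≤ (1 / η) * (Real.log (∑ i ∈ s, Real.exp (η * b i)) + η * K) :=
      mul_le_mul_of_nonneg_left hlog (by positivity)
    _ = _ := by field_simp

theorem smoothedXY_le_add {d : ℕ} {Φ : Finset (Fin d → ℝ)} (hΦ : Φ.Nonempty)
    (hΦnorm : ∀ φ ∈ Φ, Real.sqrt (φ ⬝ᵥ φ) ≤ 1) {Λ₀ Λ Λ' : Matrix (Fin d) (Fin d) ℝ}
    (hΛ₀ : Λ₀.PosDef) {η : ℝ} (hη : 0 < η) (hΛ : Λ.PosSemidef) (hΛ' : Λ'.PosSemidef) :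
    smoothedXY Φ Λ₀ η Λ ≤ smoothedXY Φ Λ₀ η Λ' + opNorm Λ₀⁻¹ ^ 2 * opNorm (Λ - Λ') := by
  refine smoothed_max_le_add hΦ hη fun φ hφ => ?_
  have h := (dotProduct_mulVec_le_opNorm _ (hΦnorm φ hφ)).trans
    (opNorm_inv_add_sub_inv_add_le hΛ₀ hΛ hΛ')
  rw [sub_mulVec, dotProduct_sub] at h
  linarith

/-- **Lipschitz bound for the smoothed XY-design objective.** -/
theorem smoothedXY_lipschitz
    (d : ℕ) (hd : 0 < d)
    (Φ : Finset (Fin d → ℝ)) (hΦ : Φ.Nonempty)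
    (hΦnorm : ∀ φ ∈ Φ, Real.sqrt (φ ⬝ᵥ φ) ≤ 1)
    (Λ₀ : Matrix (Fin d) (Fin d) ℝ) (hΛ₀ : Λ₀.PosDef)
    (η : ℝ) (hη : 0 < η)
    (Λ Λ' : Matrix (Fin d) (Fin d) ℝ)
    (hΛ : Λ.PosSemidef) (hΛ' : Λ'.PosSemidef)
    (hΛop : opNorm Λ ≤ 1) (hΛ'op : opNorm Λ' ≤ 1) :
    |smoothedXY Φ Λ₀ η Λ - smoothedXY Φ Λ₀ η Λ'| ≤
      opNorm Λ₀⁻¹ ^ 2 * opNorm (Λ - Λ') := by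
  have h := smoothedXY_le_add hΦ hΦnorm hΛ₀ hη hΛ hΛ'
  have h' := smoothedXY_le_add hΦ hΦnorm hΛ₀ hη hΛ' hΛ
  rw [opNorm_sub_comm Λ' Λ] at h'
  rw [abs_sub_le_iff]
  constructor <;> linarith
end

section
/- The function Λ ↦ f(Λ) is convex on the convex cone of symmetric positive semidefinite d×d real matrices: for all symmetric positive semidefinite Λ, Λ' and all t ∈ [0,1], f( (1−t)·Λ + t·Λ' ) ≤ (1−t)·f(Λ) + t·f(Λ'). -/
open Matrix

/-- Young's inequality for the quadratic form of a positive definite matrix and its inverse. -/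
theorem two_mul_dotProduct_sub_le_dotProduct_inv_mulVec {n : Type*} [Fintype n] [DecidableEq n]
    {A : Matrix n n ℝ} (hA : A.PosDef) (φ x : n → ℝ) :
    2 * (φ ⬝ᵥ x) - x ⬝ᵥ A *ᵥ x ≤ φ ⬝ᵥ A⁻¹ *ᵥ φ := by
  have hAy : A *ᵥ (A⁻¹ *ᵥ φ) = φ := by
    rw [mulVec_mulVec, mul_nonsing_inv _ ((isUnit_iff_isUnit_det A).1 hA.isUnit), one_mulVec]
  have hsymm : (A⁻¹ *ᵥ φ) ⬝ᵥ A *ᵥ x = φ ⬝ᵥ x := by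
    have hT : Aᵀ = A := (conjTranspose_eq_transpose_of_trivial A).symm.trans hA.isHermitian.eq
    rw [dotProduct_mulVec, ← mulVec_transpose, hT, hAy]
  have h := hA.posSemidef.dotProduct_mulVec_nonneg (x - A⁻¹ *ᵥ φ)
  simp only [star_trivial, mulVec_sub, sub_dotProduct, dotProduct_sub, hAy, hsymm] at h
  rw [dotProduct_comm x φ, dotProduct_comm _ φ] at h
  linarith

/-- The quadratic form of the inverse is convex on positive definite matrices. -/
theorem dotProduct_inv_mulVec_convex {n : Type*} [Fintype n] [DecidableEq n]
    {A B : Matrix n n ℝ} (hA : A.PosDef) (hB : B.PosDef) {a b : ℝ} (ha : 0 ≤ a) (hb : 0 ≤ b)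
    (hab : a + b = 1) (φ : n → ℝ) :
    φ ⬝ᵥ (a • A + b • B)⁻¹ *ᵥ φ ≤ a * (φ ⬝ᵥ A⁻¹ *ᵥ φ) + b * (φ ⬝ᵥ B⁻¹ *ᵥ φ) := by
  have hC : (a • A + b • B).PosDef := by
    rcases ha.eq_or_lt with rfl | ha
    · obtain rfl : b = 1 := by linarith
      simpa using hB
    · exact (hA.smul ha).add_posSemidef (hB.posSemidef.smul hb)
  set x := (a • A + b • B)⁻¹ *ᵥ φ with hx
  have hCx : (a • A + b • B) *ᵥ x = φ := by
    rw [hx, mulVec_mulVec, mul_nonsing_inv _ ((isUnit_iff_isUnit_det _).1 hC.isUnit), one_mulVec]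
  have hquad : a * (x ⬝ᵥ A *ᵥ x) + b * (x ⬝ᵥ B *ᵥ x) = φ ⬝ᵥ x := by
    rw [dotProduct_comm φ x, ← hCx]
    simp [add_mulVec, smul_mulVec, dotProduct_add, dotProduct_smul]
  have h₁ := mul_le_mul_of_nonneg_left (two_mul_dotProduct_sub_le_dotProduct_inv_mulVec hA φ x) ha
  have h₂ := mul_le_mul_of_nonneg_left (two_mul_dotProduct_sub_le_dotProduct_inv_mulVec hB φ x) hb
  have hsum : a * (φ ⬝ᵥ x) + b * (φ ⬝ᵥ x) = φ ⬝ᵥ x := by rw [← add_mul, hab, one_mul]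
  linarith

/-- The log-sum-exp function is convex. -/
theorem log_sum_exp_convex {ι : Type*} {s : Finset ι} (hs : s.Nonempty) (u v : ι → ℝ) {a b : ℝ}
    (ha : 0 ≤ a) (hb : 0 ≤ b) (hab : a + b = 1) :
    Real.log (∑ i ∈ s, Real.exp (a * u i + b * v i)) ≤
      a * Real.log (∑ i ∈ s, Real.exp (u i)) + b * Real.log (∑ i ∈ s, Real.exp (v i)) := by
  have hpos (w : ι → ℝ) : 0 < ∑ i ∈ s, Real.exp (w i) :=
    Finset.sum_pos (fun i _ => Real.exp_pos _) hs
  set S := ∑ i ∈ s, Real.exp (u i)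
  set T := ∑ i ∈ s, Real.exp (v i)
  have hS : 0 < S := hpos u
  have hT : 0 < T := hpos v
  rw [Real.log_le_iff_le_exp (hpos _)]
  have key (i : ι) : Real.exp (a * u i + b * v i) ≤
      Real.exp (a * Real.log S + b * Real.log T) *
        (a * (Real.exp (u i) / S) + b * (Real.exp (v i) / T)) := by
    have h := convexOn_exp.2 (Set.mem_univ (u i - Real.log S)) (Set.mem_univ (v i - Real.log T))
      ha hb hab
    simp only [smul_eq_mul, Real.exp_sub, Real.exp_log hS, Real.exp_log hT] at h
    calc Real.exp (a * u i + b * v i)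
        = Real.exp (a * Real.log S + b * Real.log T) *
            Real.exp (a * (u i - Real.log S) + b * (v i - Real.log T)) := by
          rw [← Real.exp_add]; ring_nf
      _ ≤ _ := by gcongr
  refine (Finset.sum_le_sum fun i _ => key i).trans_eq ?_
  rw [← Finset.mul_sum, Finset.sum_add_distrib, ← Finset.mul_sum, ← Finset.mul_sum,
    ← Finset.sum_div, ← Finset.sum_div, div_self hS.ne', div_self hT.ne', mul_one, mul_one, hab,
    mul_one]

/-- **Convexity of the smoothed XY-design objective on the PSD cone.** -/
theorem smoothedXY_convexOn_psd
    (d : ℕ) (hd : 0 < d)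
    (Φ : Finset (Fin d → ℝ)) (hΦ : Φ.Nonempty)
    (Λ₀ : Matrix (Fin d) (Fin d) ℝ) (hΛ₀ : Λ₀.PosDef)
    (η : ℝ) (hη : 0 < η)
    (Λ Λ' : Matrix (Fin d) (Fin d) ℝ)
    (hΛ : Λ.PosSemidef) (hΛ' : Λ'.PosSemidef)
    (t : ℝ) (ht : t ∈ Set.Icc (0 : ℝ) 1) :
    smoothedXY Φ Λ₀ η ((1 - t) • Λ + t • Λ') ≤
      (1 - t) * smoothedXY Φ Λ₀ η Λ + t * smoothedXY Φ Λ₀ η Λ' := by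
  obtain ⟨ht0, ht1⟩ := ht
  have ha : 0 ≤ 1 - t := sub_nonneg.2 ht1
  have hab : 1 - t + t = 1 := sub_add_cancel 1 t
  have hmix : (1 - t) • Λ + t • Λ' + Λ₀ = (1 - t) • (Λ + Λ₀) + t • (Λ' + Λ₀) := by
    module
  have hlog : Real.log (∑ φ ∈ Φ, Real.exp (η * (φ ⬝ᵥ ((1 - t) • Λ + t • Λ' + Λ₀)⁻¹ *ᵥ φ))) ≤
      (1 - t) * Real.log (∑ φ ∈ Φ, Real.exp (η * (φ ⬝ᵥ (Λ + Λ₀)⁻¹ *ᵥ φ))) +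
        t * Real.log (∑ φ ∈ Φ, Real.exp (η * (φ ⬝ᵥ (Λ' + Λ₀)⁻¹ *ᵥ φ))) := by
    refine le_trans (Real.log_le_log (Finset.sum_pos (fun _ _ => Real.exp_pos _) hΦ)
      (Finset.sum_le_sum fun φ _ => Real.exp_le_exp.2 ?_)) (log_sum_exp_convex hΦ _ _ ha ht0 hab)
    have h := mul_le_mul_of_nonneg_left (dotProduct_inv_mulVec_convex
      (PosDef.posSemidef_add hΛ hΛ₀) (PosDef.posSemidef_add hΛ' hΛ₀) ha ht0 hab φ) hη.le
    rw [hmix]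
    linarith
  have h := mul_le_mul_of_nonneg_left hlog (one_div_pos.2 hη).le
  unfold smoothedXY
  linarith
end

section
/- Let (Ω, 𝓕, ℙ) be a probability space with a filtration (𝓕_k)_{k=0}^K, and let φ_1, …, φ_K be random vectors in ℝ^d such that each φ_k is 𝓕_k-measurable and ‖φ_k‖₂ ≤ 1 almost surely. Let M_k := 𝔼[ φ_k φ_kᵀ | 𝓕_{k−1} ] denote the conditional second-moment matrices. Then for every δ ∈ (0,1), with probability at least 1 − δ, ‖ (1/K)·Σ_{k=1}^K M_k − (1/K)·Σ_{k=1}^K φ_k φ_kᵀ ‖_op ≤ √( (8d·log(1 + 8√K) + 8·log(1/δ)) / K ), where ‖·‖_op denotes the matrix operator norm. -/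
open Matrix MeasureTheory

open ProbabilityTheory in
/-- Hoeffding's lemma for the Bernoulli distribution. -/
theorem one_add_mul_exp_sub_one_mul_exp_neg_le {p : ℝ} (hp : p ∈ Set.Icc (0 : ℝ) 1) (t : ℝ) :
    (1 + p * (Real.exp t - 1)) * Real.exp (-(t * p)) ≤ Real.exp (t ^ 2 / 8) := by
  have h := (hasSubgaussianMGF_of_mem_Icc (μ := bernoulliMeasure (1 : ℝ) 0 ⟨p, hp⟩) (X := id)
    (a := 0) (b := 1) aemeasurable_id ?_).mgf_le t
  · simp only [mgf, integral_bernoulliMeasure, id, smul_eq_mul] at h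
    have e : Real.exp (t * (1 - p)) = Real.exp t * Real.exp (-(t * p)) := by
      rw [← Real.exp_add]; ring_nf
    have e' : t * (0 - p) = -(t * p) := by ring
    simp only [mul_one, mul_zero, add_zero, e, e'] at h
    refine (le_of_eq ?_).trans (h.trans (le_of_eq ?_))
    · ring
    · norm_num; ring
  · rw [ae_iff]
    simp [bernoulliMeasure_def]

theorem norm_exp_le_of_abs_le {x C : ℝ} (h : |x| ≤ C) : ‖Real.exp x‖ ≤ Real.exp C := by
  rw [Real.norm_eq_abs, Real.abs_exp]
  exact Real.exp_le_exp.2 ((le_abs_self x).trans h)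

theorem condExp_mem_Icc {Ω : Type*} {m m0 : MeasurableSpace Ω} {μ : Measure Ω}
    [IsProbabilityMeasure μ] (hm : m ≤ m0) {X : Ω → ℝ} (hX : Integrable X μ) {a b : ℝ}
    (hX01 : ∀ᵐ ω ∂μ, X ω ∈ Set.Icc a b) :
    ∀ᵐ ω ∂μ, (μ[X | m]) ω ∈ Set.Icc a b := by
  have h0 := condExp_mono (m := m) (integrable_const a) hX (hX01.mono fun ω h => h.1)
  have h1 := condExp_mono (m := m) hX (integrable_const b) (hX01.mono fun ω h => h.2)
  rw [condExp_const hm] at h0 h1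
  filter_upwards [h0, h1] with ω h0 h1 using ⟨h0, h1⟩

/-- Adding a centred `[0, 1]`-valued increment multiplies the moment generating function by at most
`exp (t ^ 2 / 8)`. -/
theorem integral_exp_add_sub_condExp_le {Ω : Type*} {m m0 : MeasurableSpace Ω} {μ : Measure Ω}
    [IsProbabilityMeasure μ] (hm : m ≤ m0) {X Y : Ω → ℝ} (hX : AEStronglyMeasurable X μ)
    (hX01 : ∀ᵐ ω ∂μ, X ω ∈ Set.Icc (0 : ℝ) 1) (hY : StronglyMeasurable[m] Y) {C : ℝ}
    (hYC : ∀ᵐ ω ∂μ, |Y ω| ≤ C) (t : ℝ) :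
    ∫ ω, Real.exp (t * (Y ω + (X ω - (μ[X | m]) ω))) ∂μ ≤
      Real.exp (t ^ 2 / 8) * ∫ ω, Real.exp (t * Y ω) ∂μ := by
  have hXint : Integrable X μ := .of_mem_Icc 0 1 hX.aemeasurable hX01
  have hp01 := condExp_mem_Icc hm hXint hX01
  set p := μ[X | m] with hp
  have hpm : StronglyMeasurable[m] p := stronglyMeasurable_condExp
  set Z : Ω → ℝ := fun ω => Real.exp (t * (Y ω - p ω)) with hZ
  have hZm : StronglyMeasurable[m] Z :=
    Real.continuous_exp.comp_stronglyMeasurable ((hY.sub hpm).const_mul t)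
  have hZb : ∀ᵐ ω ∂μ, ‖Z ω‖ ≤ Real.exp (|t| * (C + 1)) := by
    filter_upwards [hYC, hp01] with ω h1 h2
    refine norm_exp_le_of_abs_le ?_
    rw [abs_mul]
    gcongr
    refine (abs_sub _ _).trans (add_le_add h1 ?_)
    rw [abs_of_nonneg h2.1]; exact h2.2
  have hZint : Integrable Z μ := .of_bound (hZm.mono hm).aestronglyMeasurable _ hZb
  have hZX : Integrable (fun ω => Z ω * X ω) μ :=
    hXint.bdd_mul (hZm.mono hm).aestronglyMeasurable hZb
  have hZp : Integrable (fun ω => Z ω * p ω) μ :=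
    integrable_condExp.bdd_mul (hZm.mono hm).aestronglyMeasurable hZb
  have hswap : ∫ ω, Z ω * X ω ∂μ = ∫ ω, Z ω * p ω ∂μ := by
    have h := integral_condExp hm (μ := μ) (f := Z * X)
    rw [integral_congr_ae (condExp_mul_of_stronglyMeasurable_left hZm hZX hXint)] at h
    exact h.symm
  have hYint : Integrable (fun ω => Real.exp (t * Y ω)) μ := by
    refine .of_bound (C := Real.exp (|t| * C)) (Real.continuous_exp.comp_stronglyMeasurable
      ((hY.mono hm).const_mul t)).aestronglyMeasurable ?_
    filter_upwards [hYC] with ω h1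
    refine norm_exp_le_of_abs_le ?_
    rw [abs_mul]
    gcongr
  calc ∫ ω, Real.exp (t * (Y ω + (X ω - p ω))) ∂μ
      ≤ ∫ ω, (Z ω + (Real.exp t - 1) * (Z ω * X ω)) ∂μ := by
        refine integral_mono_of_nonneg (.of_forall fun ω => (Real.exp_pos _).le)
          (hZint.add (hZX.const_mul _)) ?_
        filter_upwards [hX01] with ω h
        have hconv := convexOn_exp.2 (Set.mem_univ 0) (Set.mem_univ t)
          (sub_nonneg.2 h.2) h.1 (by ring)
        simp only [smul_eq_mul, mul_zero, zero_add, Real.exp_zero, mul_one] at hconv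
        calc Real.exp (t * (Y ω + (X ω - p ω))) = Z ω * Real.exp (X ω * t) := by
              rw [hZ, ← Real.exp_add]; ring_nf
          _ ≤ Z ω * (1 - X ω + X ω * Real.exp t) := by gcongr
          _ = _ := by ring
    _ = ∫ ω, (Z ω + (Real.exp t - 1) * (Z ω * p ω)) ∂μ := by
        rw [integral_add hZint (hZX.const_mul _), integral_add hZint (hZp.const_mul _),
          integral_const_mul, integral_const_mul, hswap]
    _ ≤ ∫ ω, Real.exp (t ^ 2 / 8) * Real.exp (t * Y ω) ∂μ := by
        refine integral_mono_ae (hZint.add (hZp.const_mul _)) (hYint.const_mul _) ?_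
        filter_upwards [hp01] with ω h
        calc Z ω + (Real.exp t - 1) * (Z ω * p ω)
            = (1 + p ω * (Real.exp t - 1)) * Real.exp (-(t * p ω)) * Real.exp (t * Y ω) := by
              rw [mul_assoc, ← Real.exp_add, hZ]; ring_nf
          _ ≤ _ := by
              gcongr
              exact one_add_mul_exp_sub_one_mul_exp_neg_le h t
    _ = _ := integral_const_mul _ _

open ProbabilityTheory in
/-- **Azuma–Hoeffding**: the sum of `n` centred increments with values in `[0, 1]` is sub-Gaussian
with parameter `n / 4`. -/
theorem hasSubgaussianMGF_sum_sub_condExp {Ω : Type*} {m0 : MeasurableSpace Ω} {μ : Measure Ω}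
    [IsProbabilityMeasure μ] (ℱ : Filtration ℕ m0) {X : ℕ → Ω → ℝ} {n : ℕ}
    (hX : ∀ k < n, StronglyMeasurable[ℱ (k + 1)] (X k))
    (hX01 : ∀ k < n, ∀ᵐ ω ∂μ, X k ω ∈ Set.Icc (0 : ℝ) 1) :
    HasSubgaussianMGF (fun ω => ∑ k ∈ Finset.range n, (X k ω - (μ[X k | ℱ k]) ω)) (n / 4) μ := by
  have hsm : ∀ j ≤ n, StronglyMeasurable[ℱ j]
      (fun ω => ∑ k ∈ Finset.range j, (X k ω - (μ[X k | ℱ k]) ω)) := by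
    intro j hj
    refine Finset.stronglyMeasurable_fun_sum _ fun k hk => ?_
    have hkj := Finset.mem_range.1 hk
    exact ((hX k (hkj.trans_le hj)).mono (ℱ.mono hkj)).sub
      (stronglyMeasurable_condExp.mono (ℱ.mono hkj.le))
  have hbd : ∀ j ≤ n, ∀ᵐ ω ∂μ, |∑ k ∈ Finset.range j, (X k ω - (μ[X k | ℱ k]) ω)| ≤ j := by
    intro j hj
    have h : ∀ k ∈ Finset.range j, ∀ᵐ ω ∂μ, |X k ω - (μ[X k | ℱ k]) ω| ≤ 1 := by
      intro k hk
      have hkn := (Finset.mem_range.1 hk).trans_le hj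
      filter_upwards [hX01 k hkn, condExp_mem_Icc (ℱ.le k) (.of_mem_Icc 0 1
        ((hX k hkn).mono (ℱ.le _)).measurable.aemeasurable (hX01 k hkn)) (hX01 k hkn)] with ω h1 h2
      exact abs_le.2 ⟨by linarith [h1.1, h2.2], by linarith [h1.2, h2.1]⟩
    filter_upwards [(Filter.eventually_all_finset _).2 h] with ω hω
    refine (Finset.abs_sum_le_sum_abs _ _).trans ((Finset.sum_le_sum hω).trans ?_)
    simp
  refine ⟨fun t => integrable_exp_mul_of_mem_Icc (a := -n) (b := n)
    ((hsm n le_rfl).mono (ℱ.le n)).measurable.aemeasurable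
    ((hbd n le_rfl).mono fun ω h => abs_le.1 h), fun t => ?_⟩
  suffices ∀ j ≤ n, ∫ ω, Real.exp (t * ∑ k ∈ Finset.range j, (X k ω - (μ[X k | ℱ k]) ω)) ∂μ ≤
      Real.exp (j * (t ^ 2 / 8)) by
    refine (this n le_rfl).trans (le_of_eq ?_)
    push_cast
    ring_nf
  intro j
  induction j with
  | zero => simp
  | succ j ih =>
    intro hj
    simp only [Finset.sum_range_succ]
    refine (integral_exp_add_sub_condExp_le (ℱ.le j)
      ((hX j hj).mono (ℱ.le _)).aestronglyMeasurable (hX01 j hj) (hsm j (by lia))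
      (hbd j (by lia)) t).trans ?_
    refine (mul_le_mul_of_nonneg_left (ih (by lia)) (Real.exp_pos _).le).trans (le_of_eq ?_)
    rw [← Real.exp_add]
    push_cast
    ring_nf

/-- A symmetric operator on a nontrivial finite-dimensional real inner product space has an
eigenvalue whose absolute value is its operator norm. -/
theorem ContinuousLinearMap.exists_norm_eq_one_apply_eq_smul_abs_eq_norm {E : Type*}
    [NormedAddCommGroup E] [InnerProductSpace ℝ E] [FiniteDimensional ℝ E] [Nontrivial E]
    {T : E →L[ℝ] E}
    (hT : (T : E →ₗ[ℝ] E).IsSymmetric) :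
    ∃ (x : E) (l : ℝ), ‖x‖ = 1 ∧ T x = l • x ∧ |l| = ‖T‖ := by
  have hcont : Continuous fun x : E => |inner ℝ (T x) x| := by fun_prop
  obtain ⟨x, hx, hmax⟩ := (isCompact_sphere (0 : E) 1).exists_isMaxOn
    (NormedSpace.sphere_nonempty.2 zero_le_one) hcont.continuousOn
  have hx1 : ‖x‖ = 1 := by simpa using hx
  have hnorm : |inner ℝ (T x) x| = ‖T‖ := by
    refine le_antisymm ?_ ?_
    · refine (abs_real_inner_le_norm _ _).trans ?_
      simpa [hx1] using T.le_opNorm x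
    · rw [T.norm_eq_iSup_rayleighQuotient hT]
      refine ciSup_le fun y => ?_
      rcases eq_or_ne y 0 with rfl | hy
      · simp
      have hy' : ‖y‖ ≠ 0 := norm_ne_zero_iff.2 hy
      have h := hmax (show ‖y‖⁻¹ • y ∈ Metric.sphere (0 : E) 1 by simp [norm_smul, hy'])
      have hr := T.rayleigh_smul y (inv_ne_zero hy')
      rw [← hr]
      simpa [ContinuousLinearMap.rayleighQuotient, ContinuousLinearMap.reApplyInnerSelf_apply,
        norm_smul, hy'] using h
  refine ⟨x, inner ℝ (T x) x, hx1, ?_, hnorm⟩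
  have hle : ‖T x‖ ≤ ‖T‖ := by simpa [hx1] using T.le_opNorm x
  have hsq : inner ℝ (T x) x ^ 2 = ‖T‖ ^ 2 := by rw [← hnorm, sq_abs]
  have h0 : ‖T x - inner ℝ (T x) x • x‖ ^ 2 ≤ 0 := by
    rw [norm_sub_sq_real, inner_smul_right, norm_smul, hx1, Real.norm_eq_abs, mul_one, sq_abs]
    nlinarith [norm_nonneg (T x)]
  exact sub_eq_zero.1 (norm_eq_zero.1 (pow_eq_zero_iff two_ne_zero |>.1
    (le_antisymm h0 (sq_nonneg _))))

/-- The norm of a symmetric operator is at most twice the largest absolute value of its quadratic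
form on a `1 / 2`-net of the unit sphere consisting of unit vectors. -/
theorem ContinuousLinearMap.exists_norm_le_two_mul_abs_inner {E : Type*}
    [NormedAddCommGroup E] [InnerProductSpace ℝ E] [FiniteDimensional ℝ E] [Nontrivial E]
    {T : E →L[ℝ] E}
    (hT : (T : E →ₗ[ℝ] E).IsSymmetric) {s : Set E} (hs : ∀ v ∈ s, ‖v‖ = 1)
    (hcov : ∀ x : E, ‖x‖ = 1 → ∃ v ∈ s, ‖v - x‖ ≤ 1 / 2) :
    ∃ v ∈ s, ‖T‖ ≤ 2 * |inner ℝ v (T v)| := by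
  obtain ⟨x, l, hx, hTx, hl⟩ := T.exists_norm_eq_one_apply_eq_smul_abs_eq_norm hT
  obtain ⟨v, hv, hvx⟩ := hcov x hx
  refine ⟨v, hv, ?_⟩
  set w := v - x with hw
  have hvw : v = x + w := by simp [hw]
  have hxw : inner ℝ x w = -‖w‖ ^ 2 / 2 := by
    have h := norm_add_sq_real x w
    rw [← hvw, hs v hv, hx] at h
    linarith
  have hxTw : inner ℝ x (T w) = l * inner ℝ x w := by
    have h : inner ℝ (T x) w = inner ℝ x (T w) := hT x w
    rw [← h, hTx, real_inner_smul_left]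
  have hq : inner ℝ v (T v) = l * (1 - ‖w‖ ^ 2) + inner ℝ w (T w) := by
    rw [hvw, map_add, inner_add_left, inner_add_right, inner_add_right, hxTw, hTx,
      real_inner_smul_right, real_inner_smul_right, real_inner_comm x w, hxw,
      real_inner_self_eq_norm_sq, hx]
    ring
  have hwT : |inner ℝ w (T w)| ≤ ‖T‖ * ‖w‖ ^ 2 := by
    refine (abs_real_inner_le_norm _ _).trans ?_
    nlinarith [T.le_opNorm w, norm_nonneg w]
  have hw2 : ‖w‖ ^ 2 ≤ 1 / 4 := by nlinarith [norm_nonneg w]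
  have hlw : |l * (1 - ‖w‖ ^ 2)| = ‖T‖ * (1 - ‖w‖ ^ 2) := by
    rw [abs_mul, hl, abs_of_nonneg (by linarith)]
  have htri : ‖T‖ * (1 - ‖w‖ ^ 2) - ‖T‖ * ‖w‖ ^ 2 ≤ |inner ℝ v (T v)| := by
    have h := abs_sub_abs_le_abs_sub (l * (1 - ‖w‖ ^ 2)) (-inner ℝ w (T w))
    rw [abs_neg, sub_neg_eq_add, ← hq, hlw] at h
    linarith
  nlinarith [norm_nonneg T]

open Metric Module in
/-- The unit sphere of a real normed space of dimension `d` has a `1 / 2`-net with at most `5 ^ d`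
points. -/
theorem exists_finset_half_net_sphere (E : Type*) [NormedAddCommGroup E] [NormedSpace ℝ E]
    [FiniteDimensional ℝ E] :
    ∃ s : Finset E, (∀ v ∈ s, ‖v‖ = 1) ∧ (∀ x : E, ‖x‖ = 1 → ∃ v ∈ s, ‖v - x‖ ≤ 1 / 2) ∧
      s.card ≤ 5 ^ finrank ℝ E := by
  classical
  have hcard : ∀ t : Finset E, (t : Set E) ⊆ sphere 0 2 →
      IsSeparated ((1 : NNReal) : ENNReal) (t : Set E) → t.card ≤ 5 ^ finrank ℝ E := by
    intro t ht hsep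
    refine Besicovitch.card_le_of_separated t (fun c hc => ?_) fun c hc d hd hcd => ?_
    · exact (mem_sphere_zero_iff_norm.1 (ht hc)).le
    · have h : ((1 : NNReal) : ENNReal) < edist c d := hsep hc hd hcd
      rw [edist_dist, dist_eq_norm, ENNReal.coe_one, ENNReal.one_lt_ofReal] at h
      exact h.le
  have hpack : packingNumber 1 (sphere (0 : E) 2) ≤ (5 ^ finrank ℝ E : ℕ) := by
    refine iSup_le fun C => iSup_le fun hC => iSup_le fun hsep => ?_
    by_contra! hlt
    obtain ⟨t, htC, htcard⟩ := Set.exists_subset_encard_eq (Order.add_one_le_of_lt hlt)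
    have hfin : t.Finite := Set.finite_of_encard_eq_coe (k := 5 ^ finrank ℝ E + 1)
      (by simpa using htcard)
    lift t to Finset E using hfin
    have h := hcard t (htC.trans hC) (hsep.mono htC)
    rw [Set.encard_coe_eq_coe_finsetCard] at htcard
    have : t.card = 5 ^ finrank ℝ E + 1 := by exact_mod_cast htcard
    lia
  have hcov := isCover_maximalSeparatedSet (ne_top_of_le_ne_top (ENat.natCast_ne_top _) hpack)
  have hN := encard_maximalSeparatedSet (ne_top_of_le_ne_top (ENat.natCast_ne_top _) hpack)
  have hsub : maximalSeparatedSet 1 (sphere (0 : E) 2) ⊆ _ := maximalSeparatedSet_subset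
  have hsep : IsSeparated ((1 : NNReal) : ENNReal) (maximalSeparatedSet 1 (sphere (0 : E) 2)) :=
    isSeparated_maximalSeparatedSet
  generalize maximalSeparatedSet 1 (sphere (0 : E) 2) = N at *
  have hfin : N.Finite := Set.encard_ne_top_iff.1
    (hN ▸ ne_top_of_le_ne_top (ENat.natCast_ne_top _) hpack)
  lift N to Finset E using hfin
  refine ⟨N.image fun v => (1 / 2 : ℝ) • v, ?_, fun x hx => ?_,
    Finset.card_image_le.trans (hcard N hsub hsep)⟩
  · intro v hv
    obtain ⟨u, hu, rfl⟩ := Finset.mem_image.1 hv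
    have : ‖u‖ = 2 := mem_sphere_zero_iff_norm.1 (hsub hu)
    norm_num [norm_smul, this]
  · obtain ⟨u, hu, hxu⟩ := hcov (show (2 : ℝ) • x ∈ sphere (0 : E) 2 by simp [norm_smul, hx])
    refine ⟨_, Finset.mem_image_of_mem _ hu, ?_⟩
    have h : ‖(2 : ℝ) • x - u‖ ≤ 1 := by
      have : edist ((2 : ℝ) • x) u ≤ 1 := hxu
      rwa [edist_dist, dist_eq_norm, ENNReal.ofReal_le_one] at this
    have e : (1 / 2 : ℝ) • u - x = -((1 / 2 : ℝ) • ((2 : ℝ) • x - u)) := by module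
    rw [e, norm_neg, norm_smul]
    norm_num
    linarith

theorem sq_dotProduct_le_one {d : ℕ} {v w : Fin d → ℝ} (hv : v ⬝ᵥ v = 1)
    (hw : Real.sqrt (w ⬝ᵥ w) ≤ 1) : (v ⬝ᵥ w) ^ 2 ≤ 1 := by
  have h : (v ⬝ᵥ w) ^ 2 ≤ (v ⬝ᵥ v) * (w ⬝ᵥ w) := by
    simpa only [dotProduct, ← pow_two] using Finset.sum_mul_sq_le_sq_mul_sq Finset.univ v w
  rw [hv, one_mul] at h
  exact h.trans (Real.sqrt_le_one.1 hw)

theorem dotProduct_vecMulVec_self_mulVec {d : ℕ} (v w : Fin d → ℝ) :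
    v ⬝ᵥ (vecMulVec w w *ᵥ v) = (v ⬝ᵥ w) ^ 2 := by
  rw [dotProduct_mulVec, vecMul_vecMulVec, smul_dotProduct, smul_eq_mul, dotProduct_comm w v,
    pow_two]

theorem dotProduct_condExp_mulVec_ae_eq {Ω : Type*} {m m0 : MeasurableSpace Ω} {μ : Measure Ω}
    {d : ℕ} {φ : Ω → Fin d → ℝ} (hφ : ∀ i j, Integrable (fun ω => φ ω i * φ ω j) μ)
    (v : Fin d → ℝ) :
    (fun ω => v ⬝ᵥ (Matrix.of fun i j => (μ[fun ω' => φ ω' i * φ ω' j | m]) ω) *ᵥ v) =ᵐ[μ]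
      μ[fun ω => (v ⬝ᵥ φ ω) ^ 2 | m] := by
  have hexp : (fun ω => (v ⬝ᵥ φ ω) ^ 2) =
      ∑ p : Fin d × Fin d, (v p.1 * v p.2) • fun ω => φ ω p.1 * φ ω p.2 := by
    ext ω
    simp only [pow_two, dotProduct, Finset.sum_mul_sum, Fintype.sum_prod_type, Finset.sum_apply,
      Pi.smul_apply, smul_eq_mul]
    refine Finset.sum_congr rfl fun i _ => Finset.sum_congr rfl fun j _ => ?_
    ring
  rw [hexp]
  have h1 := condExp_finsetSum (μ := μ) (s := Finset.univ)
    (f := fun p : Fin d × Fin d => (v p.1 * v p.2) • fun ω => φ ω p.1 * φ ω p.2)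
    (fun p _ => (hφ p.1 p.2).smul _) m
  have h2 : ∀ᵐ ω ∂μ, ∀ p : Fin d × Fin d,
      (μ[(v p.1 * v p.2) • fun ω => φ ω p.1 * φ ω p.2 | m]) ω =
        (v p.1 * v p.2) * (μ[fun ω => φ ω p.1 * φ ω p.2 | m]) ω :=
    ae_all_iff.2 fun p => condExp_smul (v p.1 * v p.2) (fun ω => φ ω p.1 * φ ω p.2) m
  filter_upwards [h1, h2] with ω h1 h2
  rw [h1, Finset.sum_apply, Finset.sum_congr rfl fun p _ => h2 p, Fintype.sum_prod_type]
  simp only [dotProduct, mulVec, Matrix.of_apply, Finset.mul_sum]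
  refine Finset.sum_congr rfl fun i _ => Finset.sum_congr rfl fun j _ => ?_
  ring

open ProbabilityTheory in
theorem ProbabilityTheory.HasSubgaussianMGF.measureReal_abs_ge_le {Ω : Type*}
    {m0 : MeasurableSpace Ω} {μ : Measure Ω} [IsFiniteMeasure μ] {X : Ω → ℝ} {c : NNReal}
    (h : HasSubgaussianMGF X c μ) {ε : ℝ} (hε : 0 ≤ ε) : μ.real {ω | ε ≤ |X ω|} ≤ 2 * Real.exp (-ε ^ 2 / (2 * c)) := by
  have hunion : {ω | ε ≤ |X ω|} = {ω | ε ≤ X ω} ∪ {ω | ε ≤ (-X) ω} := by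
    ext ω
    simp [le_abs]
  rw [hunion, two_mul]
  exact (measureReal_union_le _ _).trans (add_le_add (h.measure_ge_le hε) (h.neg.measure_ge_le hε))

/-- The `5 ^ d` two-sided tails, each at half the confidence radius, add up to at most `δ`. -/
theorem five_pow_mul_two_mul_exp_le {d K : ℕ} (hd : 1 ≤ d) (hK : 1 ≤ K) {δ : ℝ}
    (hδ : δ ∈ Set.Ioo (0 : ℝ) 1) :
    (5 : ℝ) ^ d * (2 * Real.exp (-(4 * (d * Real.log (1 + 8 * Real.sqrt K) +
      Real.log (1 / δ))))) ≤ δ := by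
  have hK' : (1 : ℝ) ≤ Real.sqrt K := Real.one_le_sqrt.2 (by exact_mod_cast hK)
  set L := Real.log (1 + 8 * Real.sqrt K) with hL
  have h10 : (10 : ℝ) ^ d ≤ Real.exp (4 * (d * L)) := by
    have h1 : (9 : ℝ) ≤ Real.exp L := by
      rw [hL, Real.exp_log (by linarith)]; linarith
    have h2 : Real.exp (4 * (d * L)) = ((Real.exp L) ^ 4) ^ d := by
      rw [← Real.exp_nat_mul, ← Real.exp_nat_mul]; push_cast; ring_nf
    rw [h2]
    gcongr
    calc (10 : ℝ) ≤ 9 ^ 4 := by norm_num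
      _ ≤ _ := by gcongr
  have h2d : (5 : ℝ) ^ d * 2 ≤ 10 ^ d := by
    have e : (10 : ℝ) ^ d = 5 ^ d * 2 ^ d := by rw [← mul_pow]; norm_num
    rw [e]
    gcongr
    exact le_self_pow₀ one_le_two (by lia)
  have hδ4 : Real.exp (-(4 * Real.log (1 / δ))) ≤ δ := by
    have e : -(4 * Real.log (1 / δ)) = 4 * Real.log δ := by
      rw [one_div, Real.log_inv]; ring
    rw [e]
    calc Real.exp (4 * Real.log δ) ≤ Real.exp (Real.log δ) := by
          apply Real.exp_le_exp.2
          linarith [Real.log_neg hδ.1 hδ.2]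
      _ = δ := Real.exp_log hδ.1
  rw [mul_add, neg_add, Real.exp_add, Real.exp_neg]
  calc (5 : ℝ) ^ d * (2 * ((Real.exp (4 * (d * L)))⁻¹ * Real.exp (-(4 * Real.log (1 / δ)))))
      = (5 ^ d * 2 * (Real.exp (4 * (d * L)))⁻¹) * Real.exp (-(4 * Real.log (1 / δ))) := by ring
    _ ≤ 1 * δ := by
        gcongr
        rw [← div_eq_mul_inv, div_le_one (Real.exp_pos _)]
        exact h2d.trans h10
    _ = δ := one_mul δ

/-- At most `5 ^ d` unit vectors suffice to control the operator norm of every symmetric matrix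
through its quadratic form. -/
theorem exists_dotProduct_self_eq_one_net_opNorm (d : ℕ) (hd : 1 ≤ d) :
    ∃ s : Finset (Fin d → ℝ), (∀ v ∈ s, v ⬝ᵥ v = 1) ∧ s.card ≤ 5 ^ d ∧
      ∀ A : Matrix (Fin d) (Fin d) ℝ, A.IsSymm → ∃ v ∈ s, opNorm A ≤ 2 * |v ⬝ᵥ A *ᵥ v| := by
  classical
  have : Nonempty (Fin d) := ⟨⟨0, hd⟩⟩
  obtain ⟨s, hs, hcov, hcard⟩ := exists_finset_half_net_sphere (EuclideanSpace ℝ (Fin d))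
  refine ⟨s.image WithLp.ofLp, ?_, ?_, fun A hA => ?_⟩
  · intro v hv
    obtain ⟨u, hu, rfl⟩ := Finset.mem_image.1 hv
    have h := real_inner_self_eq_norm_sq u
    rw [hs u hu, EuclideanSpace.inner_eq_star_dotProduct] at h
    simpa using h
  · rw [finrank_euclideanSpace_fin] at hcard
    exact Finset.card_image_le.trans hcard
  · have hT : ((toEuclideanCLM (𝕜 := ℝ) A : EuclideanSpace ℝ (Fin d) →L[ℝ] _) :
        EuclideanSpace ℝ (Fin d) →ₗ[ℝ] EuclideanSpace ℝ (Fin d)).IsSymmetric := by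
      rw [coe_toEuclideanCLM_eq_toEuclideanLin, isSymmetric_toEuclideanLin_iff]
      exact (conjTranspose_eq_transpose_of_trivial A).trans hA
    obtain ⟨v, hv, h⟩ := ContinuousLinearMap.exists_norm_le_two_mul_abs_inner hT
      (s := (s : Set _)) hs hcov
    exact ⟨_, Finset.mem_image_of_mem _ hv, by rwa [inner_toEuclideanCLM] at h⟩

/-- **Martingale concentration of empirical covariance matrices.** -/
theorem covariance_martingale_concentration
    {Ω : Type*} {m0 : MeasurableSpace Ω} (μ : Measure Ω) [IsProbabilityMeasure μ]
    (ℱ : Filtration ℕ m0)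
    (d K : ℕ) (hK : 1 ≤ K)
    (φ : ℕ → Ω → (Fin d → ℝ))
    (hmeas : ∀ k ∈ Finset.Icc 1 K, Measurable[ℱ k] (φ k))
    (hbound : ∀ k ∈ Finset.Icc 1 K, ∀ᵐ ω ∂μ, Real.sqrt (φ k ω ⬝ᵥ φ k ω) ≤ 1)
    (M : ℕ → Ω → Matrix (Fin d) (Fin d) ℝ)
    (hM : ∀ k, ∀ i j : Fin d, ∀ ω,
      M k ω i j = (μ[fun ω' => φ k ω' i * φ k ω' j | ℱ (k - 1)]) ω)
    (δ : ℝ) (hδ : δ ∈ Set.Ioo (0 : ℝ) 1) :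
    ENNReal.ofReal (1 - δ) ≤
      μ {ω | opNorm ((K : ℝ)⁻¹ • ∑ k ∈ Finset.Icc 1 K, M k ω -
          (K : ℝ)⁻¹ • ∑ k ∈ Finset.Icc 1 K, Matrix.vecMulVec (φ k ω) (φ k ω)) ≤
        Real.sqrt ((8 * d * Real.log (1 + 8 * Real.sqrt K) + 8 * Real.log (1 / δ)) / K)} := by
  have hK0 : (0 : ℝ) < K := by exact_mod_cast hK
  set r := Real.sqrt ((8 * d * Real.log (1 + 8 * Real.sqrt K) + 8 * Real.log (1 / δ)) / K) with hr
  set A : Ω → Matrix (Fin d) (Fin d) ℝ := fun ω => (K : ℝ)⁻¹ • ∑ k ∈ Finset.Icc 1 K, M k ω -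
    (K : ℝ)⁻¹ • ∑ k ∈ Finset.Icc 1 K, Matrix.vecMulVec (φ k ω) (φ k ω) with hA
  suffices h : μ {ω | opNorm (A ω) ≤ r}ᶜ ≤ ENNReal.ofReal δ by
    rw [ENNReal.ofReal_sub _ hδ.1.le, ENNReal.ofReal_one, tsub_le_iff_right]
    calc 1 = μ Set.univ := measure_univ.symm
      _ ≤ μ {ω | opNorm (A ω) ≤ r} + μ {ω | opNorm (A ω) ≤ r}ᶜ := by
        rw [← Set.union_compl_self {ω | opNorm (A ω) ≤ r}]
        exact measure_union_le _ _
      _ ≤ _ := by gcongr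
  rcases Nat.eq_zero_or_pos d with rfl | hd
  · have hgood : {ω | opNorm (A ω) ≤ r}ᶜ = ∅ := by
      rw [Set.compl_empty_iff, Set.eq_univ_iff_forall]
      intro ω
      have h0 : opNorm (A ω) = 0 := by simp [opNorm]
      exact h0.trans_le (Real.sqrt_nonneg _)
    simp [hgood]
  have hMeq : ∀ k ω, M k ω =
      Matrix.of fun i j => (μ[fun ω' => φ k ω' i * φ k ω' j | ℱ (k - 1)]) ω :=
    fun k ω => Matrix.ext fun i j => hM k i j ω
  have hsymm : ∀ ω, (A ω).IsSymm := by
    intro ω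
    have hMs : ∀ k, (M k ω)ᵀ = M k ω := by
      intro k
      ext i j
      simp only [transpose_apply, hM, mul_comm]
    simp [hA, IsSymm, transpose_sub, transpose_sum, hMs]
  obtain ⟨s, hs, hcard, hnet⟩ := exists_dotProduct_self_eq_one_net_opNorm d hd
  have hmem : ∀ k < K, k + 1 ∈ Finset.Icc 1 K := fun k hk => Finset.mem_Icc.2 ⟨by lia, by lia⟩
  have hint : ∀ k < K, ∀ i j, Integrable (fun ω => φ (k + 1) ω i * φ (k + 1) ω j) μ := by
    intro k hk i j
    have hm := (hmeas _ (hmem k hk)).mono (ℱ.le (k + 1)) le_rfl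
    refine .of_bound (C := 1) (((measurable_pi_apply i).comp hm).mul
      ((measurable_pi_apply j).comp hm)).aestronglyMeasurable ?_
    filter_upwards [hbound _ (hmem k hk)] with ω hω
    have hcoord : ∀ l, |φ (k + 1) ω l| ≤ 1 := by
      intro l
      rw [← sq_le_one_iff_abs_le_one]
      simpa using sq_dotProduct_le_one (v := Pi.single l 1) (by simp) hω
    rw [norm_mul]
    exact mul_le_one₀ (hcoord i) (norm_nonneg _) (hcoord j)
  set X : (Fin d → ℝ) → ℕ → Ω → ℝ := fun v k ω => (v ⬝ᵥ φ (k + 1) ω) ^ 2 with hX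
  set S : (Fin d → ℝ) → Ω → ℝ :=
    fun v ω => ∑ k ∈ Finset.range K, (X v k ω - (μ[X v k | ℱ k]) ω) with hS
  have hquad : ∀ v, ∀ᵐ ω ∂μ, v ⬝ᵥ A ω *ᵥ v = -((K : ℝ)⁻¹ * S v ω) := by
    intro v
    have hall : ∀ᵐ ω ∂μ, ∀ k ∈ Finset.range K,
        v ⬝ᵥ M (k + 1) ω *ᵥ v = (μ[X v k | ℱ k]) ω := by
      refine (Filter.eventually_all_finset _).2 fun k hk => ?_
      filter_upwards [dotProduct_condExp_mulVec_ae_eq (m := ℱ k)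
        (hint k (Finset.mem_range.1 hk)) v] with ω hω
      rw [hMeq]
      exact hω
    filter_upwards [hall] with ω hω
    have hshift : ∀ f : ℕ → ℝ, ∑ k ∈ Finset.Icc 1 K, f k = ∑ k ∈ Finset.range K, f (k + 1) := by
      intro f
      rw [Finset.range_eq_Ico, Finset.sum_Ico_add' f 0 K 1]
      rfl
    simp only [hA, hS, sub_mulVec, smul_mulVec, sum_mulVec, dotProduct_sub, dotProduct_smul,
      dotProduct_sum, dotProduct_vecMulVec_self_mulVec, hshift, Finset.sum_congr rfl hω,
      Finset.sum_sub_distrib, smul_eq_mul, hX]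
    ring
  have htail : ∀ v ∈ s, μ {ω | K * r / 2 ≤ |S v ω|} ≤ ENNReal.ofReal (2 *
      Real.exp (-(4 * (d * Real.log (1 + 8 * Real.sqrt K) + Real.log (1 / δ))))) := by
    intro v hv
    have hsub := hasSubgaussianMGF_sum_sub_condExp (μ := μ) ℱ (X := X v) (n := K)
      (fun k hk => ?_) (fun k hk => ?_)
    · have h := hsub.measureReal_abs_ge_le (ε := K * r / 2) (by positivity)
      rw [← ofReal_measureReal]
      refine ENNReal.ofReal_le_ofReal (h.trans (le_of_eq ?_))
      have hL : 0 ≤ Real.log (1 + 8 * Real.sqrt K) :=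
        Real.log_nonneg (by linarith [Real.sqrt_nonneg (K : ℝ)])
      have hδL : 0 ≤ Real.log (1 / δ) := Real.log_nonneg ((one_le_div hδ.1).2 hδ.2.le)
      have hr2 : r ^ 2 = (8 * d * Real.log (1 + 8 * Real.sqrt K) + 8 * Real.log (1 / δ)) / K :=
        Real.sq_sqrt (by positivity)
      congr 2
      rw [div_pow, mul_pow, hr2]
      push_cast
      field_simp
      ring
    · have hm := hmeas _ (hmem k hk)
      refine Measurable.stronglyMeasurable (Measurable.pow_const ?_ 2)
      exact Finset.measurable_fun_sum _ fun i _ =>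
        ((measurable_pi_apply i).comp hm).const_mul (v i)
    · filter_upwards [hbound _ (hmem k hk)] with ω hω
      exact ⟨sq_nonneg _, sq_dotProduct_le_one (hs v hv) hω⟩
  calc μ {ω | opNorm (A ω) ≤ r}ᶜ ≤ μ (⋃ v ∈ s, {ω | K * r / 2 ≤ |S v ω|}) := by
        refine measure_mono_ae ?_
        filter_upwards [(Filter.eventually_all_finset s).2 fun v _ => hquad v] with ω hω hbad
        obtain ⟨v, hv, hle⟩ := hnet (A ω) (hsymm ω)
        have hlt : r < opNorm (A ω) := not_le.1 hbad
        refine Set.mem_biUnion hv ?_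
        rw [hω v hv, abs_neg, abs_mul, abs_of_pos (inv_pos.2 hK0)] at hle
        have h := hlt.trans_le hle
        rw [← div_eq_inv_mul, ← mul_div_assoc, lt_div_iff₀ hK0] at h
        show K * r / 2 ≤ |S v ω|
        linarith
    _ ≤ ∑ v ∈ s, μ {ω | K * r / 2 ≤ |S v ω|} := measure_biUnion_finset_le _ _
    _ ≤ s.card • ENNReal.ofReal (2 *
        Real.exp (-(4 * (d * Real.log (1 + 8 * Real.sqrt K) + Real.log (1 / δ))))) :=
      Finset.sum_le_card_nsmul _ _ _ htail
    _ ≤ ENNReal.ofReal δ := by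
      rw [← ENNReal.ofReal_nsmul, nsmul_eq_mul]
      refine ENNReal.ofReal_le_ofReal (le_trans ?_ (five_pow_mul_two_mul_exp_le hd hK hδ))
      gcongr
      exact_mod_cast hcard
end
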